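/- For 1 ≤ i ≤ d−2, the operators T_i on M satisfy the braid relation T_i T_{i+1} T_i = T_{i+1} T_i T_{i+1}, and for 1 ≤ i, j ≤ d−1 with |i − j| ≥ 2 they commute: T_i T_j = T_j T_i. Together with the quadratic relation T_i² = (q²−1)T_i + q², this means the operators T_1, …, T_{d−1} define a right action of the Hecke algebra H_d(q²) on M = V(z_1) ⊗ ⋯ ⊗ V(z_d). -/

import Mathlib

/-!
STATEMENT 7. The Hecke operators `T_i` on `M = V^{⊗d} ⊗ L` satisfy the braid relation
`T_i T_{i+1} T_i = T_{i+1} T_i T_{i+1}` and commute when `|i - j| ≥ 2`, so together with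
the quadratic relation they give a right action of the Hecke algebra `H_d(q²)` on
`M = V(z_1) ⊗ ⋯ ⊗ V(z_d)`.
`V` has basis `v_1, …, v_n` indexed by `Fin n`; `M` is modeled as functions from the basis
`Fin d → Fin n` of `V^{⊗d}` to the field `K` of rational functions in `z_1, …, z_d`
(the fraction field of `𝕂[z_1, …, z_d]`, in which the Laurent polynomial ring `L` embeds
and where the divisions defining `∂_i` and `π_i` are available).
-/

noncomputable section

open MvPolynomial

variable (𝕂 : Type*) [Field 𝕂] (q : 𝕂) (n d : ℕ)

/-- The field of rational functions in `z_1, …, z_d`. -/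
abbrev KF := FractionRing (MvPolynomial (Fin d) 𝕂)

/-- The variable `z_i` as a rational function. -/
def zvar (i : Fin d) : KF 𝕂 d := algebraMap (MvPolynomial (Fin d) 𝕂) (KF 𝕂 d) (X i)

/-- The scalar `q` as a rational function. -/
def qK : KF 𝕂 d := algebraMap (MvPolynomial (Fin d) 𝕂) (KF 𝕂 d) (C q)

/-- The field automorphism `s_{ij}` exchanging the variables `z_i` and `z_j`. -/
def sSwap (i j : Fin d) : KF 𝕂 d ≃+* KF 𝕂 d :=
  IsFractionRing.ringEquivOfRingEquiv (MvPolynomial.renameEquiv 𝕂 (Equiv.swap i j)).toRingEquiv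

/-- `M = V^{⊗d} ⊗ L`, as functions from the basis `Fin d → Fin n` of `V^{⊗d}`
to the coefficient field. -/
abbrev MS := (Fin d → Fin n) → KF 𝕂 d

/-- The contribution of the basis tensor `x = v_{m_1} ⊗ ⋯ ⊗ v_{m_d}` with coefficient `f`
to `T_i`. -/
def heckeContrib (i : ℕ) (hi : i + 1 < d) (m : Fin d → Fin n) (f : KF 𝕂 d) : MS 𝕂 n d :=
  let i0 : Fin d := ⟨i, by omega⟩
  let i1 : Fin d := ⟨i + 1, hi⟩
  let f' := sSwap 𝕂 d i0 i1 f
  let dpart := (zvar 𝕂 d i1 * f' - zvar 𝕂 d i0 * f) / (zvar 𝕂 d i0 - zvar 𝕂 d i1)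
  let ppart := zvar 𝕂 d i0 * (f' - f) / (zvar 𝕂 d i0 - zvar 𝕂 d i1)
  if m i0 < m i1 then
    (-(qK 𝕂 q d)) • Pi.single (m ∘ Equiv.swap i0 i1) f'
      - ((qK 𝕂 q d) ^ 2 - 1) • Pi.single m dpart
  else if m i0 = m i1 then
    -(Pi.single m f') - ((qK 𝕂 q d) ^ 2 - 1) • Pi.single m ppart
  else
    (-(qK 𝕂 q d)) • Pi.single (m ∘ Equiv.swap i0 i1) f'
      - ((qK 𝕂 q d) ^ 2 - 1) • Pi.single m ppart

/-- The Hecke operator `T_i` on `M`. -/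
def heckeT (i : ℕ) (hi : i + 1 < d) (ψ : MS 𝕂 n d) : MS 𝕂 n d :=
  ∑ m : Fin d → Fin n, heckeContrib 𝕂 q n d i hi m (ψ m)

section LocalOperator

variable {F I Y : Type*} [Field F] [LinearOrder I]

/-- The coefficient of `s · ψ m` in `T ψ m`, where `a, b` are the two tensor labels of `m`
and `x, y` the corresponding variables. -/
def diagCoeff (e x y : F) (a b : I) : F :=
  if a < b then e - e * (x / (x - y)) else if a = b then -1 - e * (x / (x - y))
  else -(e * (x / (x - y)))

/-- The coefficient of `s · ψ (σ m)` in `T ψ m`. -/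
def swapCoeff (Q : F) (a b : I) : F := if a = b then 0 else -Q

/-- The operator `T` attached to a field automorphism `s` and a permutation `σ` of labels. -/
def localHecke (Q x y : F) (s : F ≃+* F) (σ : Y → Y) (a b : Y → I) (ψ : Y → F) (m : Y) : F :=
  (Q ^ 2 - 1) * (x / (x - y)) * ψ m + diagCoeff (Q ^ 2 - 1) x y (a m) (b m) * s (ψ m)
    + swapCoeff Q (a m) (b m) * s (ψ (σ m))

lemma map_diagCoeff (s : F ≃+* F) (e x y : F) (a b : I) :
    s (diagCoeff e x y a b) = diagCoeff (s e) (s x) (s y) a b := by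
  unfold diagCoeff
  split_ifs <;> simp

lemma map_swapCoeff (s : F ≃+* F) (Q : F) (a b : I) :
    s (swapCoeff Q a b) = swapCoeff (s Q) a b := by
  unfold swapCoeff
  split_ifs <;> simp

lemma localHecke_comm {Q x y z w : F} {s t : F ≃+* F} {σ τ : Y → Y} {a b c d : Y → I}
    (hsQ : s Q = Q) (htQ : t Q = Q) (htx : t x = x) (hty : t y = y) (hsz : s z = z)
    (hsw : s w = w) (hst : ∀ f, s (t f) = t (s f)) (hστ : ∀ m, σ (τ m) = τ (σ m))
    (ha : ∀ m, a (τ m) = a m) (hb : ∀ m, b (τ m) = b m)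
    (hc : ∀ m, c (σ m) = c m) (hd : ∀ m, d (σ m) = d m) (ψ : Y → F) :
    localHecke Q x y s σ a b (localHecke Q z w t τ c d ψ) =
      localHecke Q z w t τ c d (localHecke Q x y s σ a b ψ) := by
  funext m
  simp only [localHecke, map_add, map_mul, map_sub, map_div₀, map_pow, map_one,
    map_diagCoeff, map_swapCoeff, hsQ, htQ, htx, hty, hsz, hsw, hst, hστ, ha, hb, hc, hd]
  ring

lemma localHecke_braid {Q x y z : F} (hxy : x ≠ y) (hyz : y ≠ z) (hxz : x ≠ z)
    {s t : F ≃+* F} {σ τ : Y → Y} {a b c : Y → I}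
    (hsQ : s Q = Q) (htQ : t Q = Q)
    (hsx : s x = y) (hsy : s y = x) (hsz : s z = z)
    (htx : t x = x) (hty : t y = z) (htz : t z = y)
    (hss : ∀ f, s (s f) = f) (htt : ∀ f, t (t f) = f)
    (hst : ∀ f, s (t (s f)) = t (s (t f)))
    (hσσ : ∀ m, σ (σ m) = m) (hττ : ∀ m, τ (τ m) = m)
    (hστ : ∀ m, σ (τ (σ m)) = τ (σ (τ m)))
    (hσa : ∀ m, a (σ m) = b m) (hσb : ∀ m, b (σ m) = a m) (hσc : ∀ m, c (σ m) = c m)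
    (hτa : ∀ m, a (τ m) = a m) (hτb : ∀ m, b (τ m) = c m) (hτc : ∀ m, c (τ m) = b m)
    (hσ : ∀ m, a m = b m → σ m = m) (hτ : ∀ m, b m = c m → τ m = m) (ψ : Y → F) :
    localHecke Q x y s σ a b (localHecke Q y z t τ b c (localHecke Q x y s σ a b ψ)) =
      localHecke Q y z t τ b c (localHecke Q x y s σ a b (localHecke Q y z t τ b c ψ)) := by
  have h1 : x - y ≠ 0 := sub_ne_zero.2 hxy
  have h2 : y - z ≠ 0 := sub_ne_zero.2 hyz
  have h3 : x - z ≠ 0 := sub_ne_zero.2 hxz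
  have h1' : y / (y - x) = 1 - x / (x - y) := by
    have : y - x ≠ 0 := sub_ne_zero.2 hxy.symm
    field_simp
    ring
  have h2' : z / (z - y) = 1 - y / (y - z) := by
    have : z - y ≠ 0 := sub_ne_zero.2 hyz.symm
    field_simp
    ring
  have key : x / (x - y) * (y / (y - z)) = x / (x - z) * (x / (x - y) + y / (y - z) - 1) := by
    field_simp
    ring
  funext m
  simp only [localHecke, map_add, map_mul, map_sub, map_div₀, map_pow, map_one,
    map_diagCoeff, map_swapCoeff, hsQ, htQ, hsx, hsy, hsz, htx, hty, htz, hss, htt, hst,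
    hσσ, hττ, hστ, hσa, hσb, hσc, hτa, hτb, hτc]
  simp only [diagCoeff, h1', h2']
  generalize x / (x - y) = p at *
  generalize y / (y - z) = r at *
  generalize x / (x - z) = u at *
  have hab := hσ m
  have hbc := hτ m
  have hab' : a m = b m → τ (σ (τ m)) = σ (τ m) := fun h => by rw [← hστ, hσ m h]
  have hac : a m = c m → σ (τ m) = τ m := fun h => hσ _ (by rw [hτa, hτb, h])
  have hac' : a m = c m → τ (σ m) = σ m := fun h => hτ _ (by rw [hσb, hσc, h])
  have tri : ∀ i j : I, (i < j ∧ ¬ j < i ∧ i ≠ j ∧ j ≠ i) ∨ i = j ∨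
      (j < i ∧ ¬ i < j ∧ i ≠ j ∧ j ≠ i) := fun i j =>
    (lt_trichotomy i j).imp (fun h => ⟨h, h.not_gt, h.ne, h.ne'⟩)
      (Or.imp id fun h => ⟨h, h.not_gt, h.ne', h.ne⟩)
  simp only [swapCoeff]
  generalize a m = i at *
  generalize b m = j at *
  generalize c m = k at *
  clear hσ hτ hσa hσb hσc hτa hτb hτc hσσ hστ hst h1' h2' h1 h2 h3 hsx hsy hsz htx hty htz
    hsQ htQ hxy hxz hyz hss htt
  rcases tri i j with ⟨h1, h2, h3, h4⟩ | h | ⟨h1, h2, h3, h4⟩ <;>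
  rcases tri j k with ⟨h5, h6, h7, h8⟩ | h' | ⟨h5, h6, h7, h8⟩ <;>
  rcases tri i k with ⟨h9, h10, h11, h12⟩ | h'' | ⟨h9, h10, h11, h12⟩ <;>
  first
  | (exfalso; order)
  | (clear tri
     try subst h
     try subst h'
     try subst h''
     simp only [*, lt_irrefl, if_true, if_false]
     grind)

end LocalOperator

lemma swap_braid {α : Type*} [DecidableEq α] {i j k : α} (hij : i ≠ j) (hjk : j ≠ k)
    (hik : i ≠ k) :
    Equiv.swap i j * (Equiv.swap j k * Equiv.swap i j) =
      Equiv.swap j k * (Equiv.swap i j * Equiv.swap j k) := by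
  rw [← mul_assoc, ← mul_assoc, Equiv.swap_mul_swap_mul_swap hij hik, Equiv.swap_comm i j,
    Equiv.swap_comm j k, Equiv.swap_mul_swap_mul_swap hjk.symm hik.symm, Equiv.swap_comm]

lemma swap_disjoint {α : Type*} [DecidableEq α] {i j k l : α} (hik : i ≠ k) (hil : i ≠ l)
    (hjk : j ≠ k) (hjl : j ≠ l) : Equiv.Perm.Disjoint (Equiv.swap i j) (Equiv.swap k l) := by
  intro x
  by_cases hi : x = i
  · subst hi
    exact Or.inr (Equiv.swap_apply_of_ne_of_ne hik hil)
  by_cases hj : x = j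
  · subst hj
    exact Or.inr (Equiv.swap_apply_of_ne_of_ne hjk hjl)
  exact Or.inl (Equiv.swap_apply_of_ne_of_ne hi hj)

lemma zvar_injective : Function.Injective (zvar 𝕂 d) := fun _ _ h =>
  MvPolynomial.X_injective (IsFractionRing.injective (MvPolynomial (Fin d) 𝕂) (KF 𝕂 d) h)

lemma sSwap_algebraMap (i j : Fin d) (p : MvPolynomial (Fin d) 𝕂) :
    sSwap 𝕂 d i j (algebraMap _ _ p) = algebraMap _ _ (rename (Equiv.swap i j) p) := by
  simp [sSwap]

lemma sSwap_zvar (i j k : Fin d) :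
    sSwap 𝕂 d i j (zvar 𝕂 d k) = zvar 𝕂 d (Equiv.swap i j k) := by
  simp [zvar, sSwap_algebraMap]

lemma sSwap_qK (i j : Fin d) : sSwap 𝕂 d i j (qK 𝕂 q d) = qK 𝕂 q d := by
  simp [qK, sSwap_algebraMap]

lemma KF_ringHom_ext {f g : KF 𝕂 d →+* KF 𝕂 d}
    (h : ∀ p : MvPolynomial (Fin d) 𝕂, f (algebraMap _ _ p) = g (algebraMap _ _ p)) : f = g :=
  IsLocalization.ringHom_ext (nonZeroDivisors (MvPolynomial (Fin d) 𝕂)) (RingHom.ext h)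

lemma sSwap_sSwap (i j : Fin d) (f : KF 𝕂 d) : sSwap 𝕂 d i j (sSwap 𝕂 d i j f) = f := by
  have h : ((sSwap 𝕂 d i j).toRingHom.comp (sSwap 𝕂 d i j).toRingHom) = RingHom.id _ :=
    KF_ringHom_ext 𝕂 d fun p => by
      simp [sSwap_algebraMap, rename_rename, ← Equiv.Perm.coe_mul]
  exact congrArg (fun φ : KF 𝕂 d →+* KF 𝕂 d => φ f) h

lemma sSwap_braid {i j k : Fin d} (hij : i ≠ j) (hjk : j ≠ k) (hik : i ≠ k) (f : KF 𝕂 d) :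
    sSwap 𝕂 d i j (sSwap 𝕂 d j k (sSwap 𝕂 d i j f)) =
      sSwap 𝕂 d j k (sSwap 𝕂 d i j (sSwap 𝕂 d j k f)) := by
  have h : ((sSwap 𝕂 d i j).toRingHom.comp
        ((sSwap 𝕂 d j k).toRingHom.comp (sSwap 𝕂 d i j).toRingHom)) =
      ((sSwap 𝕂 d j k).toRingHom.comp
        ((sSwap 𝕂 d i j).toRingHom.comp (sSwap 𝕂 d j k).toRingHom)) :=
    KF_ringHom_ext 𝕂 d fun p => by
      simp only [RingHom.comp_apply, RingEquiv.toRingHom_eq_coe, RingHom.coe_coe,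
        sSwap_algebraMap, rename_rename, ← Equiv.Perm.coe_mul]
      rw [swap_braid hij hjk hik]
  exact congrArg (fun φ : KF 𝕂 d →+* KF 𝕂 d => φ f) h

lemma sSwap_comm {i j k l : Fin d} (h : Equiv.Perm.Disjoint (Equiv.swap i j) (Equiv.swap k l))
    (f : KF 𝕂 d) :
    sSwap 𝕂 d i j (sSwap 𝕂 d k l f) = sSwap 𝕂 d k l (sSwap 𝕂 d i j f) := by
  have h : ((sSwap 𝕂 d i j).toRingHom.comp (sSwap 𝕂 d k l).toRingHom) =
      ((sSwap 𝕂 d k l).toRingHom.comp (sSwap 𝕂 d i j).toRingHom) :=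
    KF_ringHom_ext 𝕂 d fun p => by
      simp only [RingHom.comp_apply, RingEquiv.toRingHom_eq_coe, RingHom.coe_coe,
        sSwap_algebraMap, rename_rename, ← Equiv.Perm.coe_mul, h.commute.eq]
  exact congrArg (fun φ : KF 𝕂 d →+* KF 𝕂 d => φ f) h

lemma heckeContrib_apply (i : ℕ) (hi : i + 1 < d) (m m' : Fin d → Fin n) (f : KF 𝕂 d) :
    heckeContrib 𝕂 q n d i hi m' f m =
      (if m' = m then ((qK 𝕂 q d) ^ 2 - 1) *
          (zvar 𝕂 d ⟨i, by omega⟩ / (zvar 𝕂 d ⟨i, by omega⟩ - zvar 𝕂 d ⟨i + 1, hi⟩)) * f +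
        diagCoeff ((qK 𝕂 q d) ^ 2 - 1) (zvar 𝕂 d ⟨i, by omega⟩) (zvar 𝕂 d ⟨i + 1, hi⟩)
          (m ⟨i, by omega⟩) (m ⟨i + 1, hi⟩) * sSwap 𝕂 d ⟨i, by omega⟩ ⟨i + 1, hi⟩ f else 0) +
      (if m' = m ∘ Equiv.swap ⟨i, by omega⟩ ⟨i + 1, hi⟩ then
        swapCoeff (qK 𝕂 q d) (m ⟨i, by omega⟩) (m ⟨i + 1, hi⟩) *
          sSwap 𝕂 d ⟨i, by omega⟩ ⟨i + 1, hi⟩ f else 0) := by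
  have hz : zvar 𝕂 d ⟨i, by omega⟩ - zvar 𝕂 d ⟨i + 1, hi⟩ ≠ 0 :=
    sub_ne_zero.2 ((zvar_injective 𝕂 d).ne (by simp))
  have hsw : m = m' ∘ Equiv.swap ⟨i, by omega⟩ ⟨i + 1, hi⟩ ↔
      m' = m ∘ Equiv.swap ⟨i, by omega⟩ ⟨i + 1, hi⟩ := by
    constructor <;> rintro rfl <;> ext <;> simp
  have hm : m' = m ∘ Equiv.swap ⟨i, by omega⟩ ⟨i + 1, hi⟩ →
      m' ⟨i, by omega⟩ = m ⟨i + 1, hi⟩ ∧ m' ⟨i + 1, hi⟩ = m ⟨i, by omega⟩ := by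
    rintro rfl
    simp
  simp only [heckeContrib, apply_ite (fun ψ : MS 𝕂 n d => ψ m), Pi.sub_apply, Pi.neg_apply,
    Pi.smul_apply, smul_eq_mul, Pi.single_apply, hsw, eq_comm (a := m) (b := m')]
  generalize zvar 𝕂 d ⟨i, by omega⟩ = x at *
  generalize zvar 𝕂 d ⟨i + 1, hi⟩ = y at *
  generalize sSwap 𝕂 d ⟨i, by omega⟩ ⟨i + 1, hi⟩ f = f'
  by_cases h : m' = m
  · subst h
    simp only [if_true, diagCoeff, swapCoeff]
    split_ifs with h1 h2 h3 h4 h5 h6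
    all_goals first
      | (exfalso; order)
      | (field_simp; ring)
  · by_cases h' : m' = m ∘ Equiv.swap ⟨i, by omega⟩ ⟨i + 1, hi⟩
    · simp only [if_neg h, if_pos h', (hm h').1, (hm h').2, swapCoeff]
      split_ifs with h1 h2 h3
      all_goals first
        | (exfalso; order)
        | simp
    · simp [h, h']

lemma heckeT_eq_localHecke (i : ℕ) (hi : i + 1 < d) :
    heckeT 𝕂 q n d i hi =
      localHecke (qK 𝕂 q d) (zvar 𝕂 d ⟨i, by omega⟩) (zvar 𝕂 d ⟨i + 1, hi⟩)
        (sSwap 𝕂 d ⟨i, by omega⟩ ⟨i + 1, hi⟩)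
        (fun m : Fin d → Fin n => m ∘ Equiv.swap ⟨i, by omega⟩ ⟨i + 1, hi⟩)
        (fun m => m ⟨i, by omega⟩) (fun m => m ⟨i + 1, hi⟩) := by
  funext ψ m
  simp [heckeT, localHecke, heckeContrib_apply, Finset.sum_apply, Finset.sum_add_distrib]

theorem heckeT_braid_and_commutation (hn : 1 ≤ n) (hd : 2 ≤ d) :
    (∀ (i : ℕ) (hi : i + 2 < d) (ψ : MS 𝕂 n d),
      heckeT 𝕂 q n d i (by omega)
          (heckeT 𝕂 q n d (i + 1) hi (heckeT 𝕂 q n d i (by omega) ψ)) =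
        heckeT 𝕂 q n d (i + 1) hi
          (heckeT 𝕂 q n d i (by omega) (heckeT 𝕂 q n d (i + 1) hi ψ))) ∧
    (∀ (i j : ℕ) (hi : i + 1 < d) (hj : j + 1 < d), 2 ≤ Int.natAbs ((i : ℤ) - j) →
      ∀ ψ : MS 𝕂 n d,
        heckeT 𝕂 q n d i hi (heckeT 𝕂 q n d j hj ψ) =
          heckeT 𝕂 q n d j hj (heckeT 𝕂 q n d i hi ψ)) := by
  constructor
  · intro i hi ψ
    have h01 : (⟨i, by omega⟩ : Fin d) ≠ ⟨i + 1, by omega⟩ := by simp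
    have h12 : (⟨i + 1, by omega⟩ : Fin d) ≠ ⟨i + 1 + 1, hi⟩ := by simp
    have h02 : (⟨i, by omega⟩ : Fin d) ≠ ⟨i + 1 + 1, hi⟩ := by simp; omega
    have hfix : ∀ (k l : Fin d) (m : Fin d → Fin n), m k = m l → m ∘ Equiv.swap k l = m := by
      intro k l m h
      funext x
      rw [Function.comp_apply, Equiv.swap_apply_def]
      split_ifs <;> simp_all
    simp only [heckeT_eq_localHecke]
    refine localHecke_braid ((zvar_injective 𝕂 d).ne h01) ((zvar_injective 𝕂 d).ne h12)
      ((zvar_injective 𝕂 d).ne h02) (sSwap_qK ..) (sSwap_qK ..) ?_ ?_ ?_ ?_ ?_ ?_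
      (sSwap_sSwap 𝕂 d _ _) (sSwap_sSwap 𝕂 d _ _) (sSwap_braid 𝕂 d h01 h12 h02)
      ?_ ?_ ?_ ?_ ?_ ?_ ?_ ?_ ?_ (fun m => hfix _ _ m) (fun m => hfix _ _ m) ψ
    case refine_9 =>
      intro m
      simp only [Function.comp_assoc, ← Equiv.Perm.coe_mul, mul_assoc, swap_braid h01 h12 h02]
    all_goals simp [sSwap_zvar, Equiv.swap_apply_of_ne_of_ne, Function.comp_assoc,
      ← Equiv.Perm.coe_mul, h02, h02.symm, h01, h12.symm]
  · intro i j hi hj hij ψ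
    have h00 : (⟨i, by omega⟩ : Fin d) ≠ ⟨j, by omega⟩ := by simp; omega
    have h01 : (⟨i, by omega⟩ : Fin d) ≠ ⟨j + 1, hj⟩ := by simp; omega
    have h10 : (⟨i + 1, hi⟩ : Fin d) ≠ ⟨j, by omega⟩ := by simp; omega
    have h11 : (⟨i + 1, hi⟩ : Fin d) ≠ ⟨j + 1, hj⟩ := by simp; omega
    have hdisj := swap_disjoint h00 h01 h10 h11
    simp only [heckeT_eq_localHecke]
    refine localHecke_comm (sSwap_qK ..) (sSwap_qK ..) ?_ ?_ ?_ ?_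
      (sSwap_comm 𝕂 d hdisj) ?_ ?_ ?_ ?_ ?_ ψ
    case refine_5 =>
      intro m
      simp only [Function.comp_assoc, ← Equiv.Perm.coe_mul, hdisj.commute.eq]
    all_goals simp [sSwap_zvar, Equiv.swap_apply_of_ne_of_ne, h00, h01, h10, h11, h00.symm,
      h01.symm, h10.symm, h11.symm]

end
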